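/- Let x be an integer, ŷ a real number, and let M = M(x − ŷ) be the generalized Rice mapping of the residual x − ŷ. Then x = (M + ⌈2ŷ⌉)/2 if M + ⌈2ŷ⌉ is even, and x = (⌈2ŷ⌉ − M − 1)/2 otherwise; that is, the decoder recovers x exactly from M and ŷ. -/

import Mathlib

open Classical in
/-- The generalized Rice mapping of a real residual. -/
noncomputable def riceMap (e : ℝ) : ℤ := if 0 ≤ e then ⌊2 * e⌋ else -⌊2 * e⌋ - 1

/-- the decoder recovers `x` exactly from `M = M(x − ŷ)` and `ŷ`. -/
theorem decoder_correct (x : ℤ) (yhat : ℝ) (M : ℤ) (hM : M = riceMap ((x : ℝ) - yhat)) :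
    (Even (M + ⌈2 * yhat⌉) → x = (M + ⌈2 * yhat⌉) / 2) ∧
    (¬ Even (M + ⌈2 * yhat⌉) → x = (⌈2 * yhat⌉ - M - 1) / 2) := by
  have hfloor : ⌊2 * ((x : ℝ) - yhat)⌋ = 2 * x - ⌈2 * yhat⌉ := by
    rw [show 2 * ((x : ℝ) - yhat) = ((2 * x : ℤ) : ℝ) + -(2 * yhat) by push_cast; ring,
      Int.floor_intCast_add, Int.floor_neg, sub_eq_add_neg]
  rw [riceMap, hfloor] at hM
  rw [Int.even_iff]
  split_ifs at hM <;> omega
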